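/- Specialization of Kummer's quadratic transformation at z = −1: Let a, b be complex numbers with Re(b) < 1 and 1 + a − b not a nonpositive integer. Then ∑_{k=0}^∞ (a)_k (b)_k (−1)^k / ((1+a−b)_k · k!) = 2^{−a} · ∑_{k=0}^∞ (a/2)_k (1/2 + a/2 − b)_k / ((1+a−b)_k · k!), and both series converge. -/

import Mathlib

open Complex Finset Filter Topology

/-- The Pochhammer symbol `(x)_k = x (x+1) ⋯ (x+k-1)`. -/
noncomputable def poch (x : ℂ) (k : ℕ) : ℂ := (ascPochhammer ℂ k).eval x

lemma poch_zero (x : ℂ) : poch x 0 = 1 := by simp [poch]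

lemma poch_succ (x : ℂ) (k : ℕ) : poch x (k + 1) = poch x k * (x + k) :=
  ascPochhammer_succ_eval k x

lemma poch_eq_prod (x : ℂ) (k : ℕ) : poch x k = ∏ j ∈ range k, (x + j) := by
  induction k with
  | zero => simp [poch_zero]
  | succ k ih => rw [poch_succ, prod_range_succ, ih]

lemma poch_succ_left (x : ℂ) (k : ℕ) : poch x (k + 1) = x * poch (x + 1) k := by
  induction k with
  | zero => simp [poch_succ, poch_zero]
  | succ k ih => rw [poch_succ, ih, poch_succ]; push_cast; ring

lemma poch_ne_zero {x : ℂ} (hx : ∀ m : ℕ, x ≠ -(m : ℂ)) (k : ℕ) : poch x k ≠ 0 := by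
  rw [poch_eq_prod]
  exact prod_ne_zero_iff.2 fun j _ h => hx j (eq_neg_of_add_eq_zero_left h)

lemma poch_one (k : ℕ) : poch 1 k = (k.factorial : ℂ) := ascPochhammer_eval_one ℂ k

lemma one_ne_neg_natCast (m : ℕ) : (1 : ℂ) ≠ -(m : ℂ) := fun h =>
  Nat.cast_add_one_ne_zero (R := ℂ) m (by linear_combination h)

lemma ne_neg_natCast_add {x : ℂ} (hx : ∀ m : ℕ, x ≠ -(m : ℂ)) (n : ℕ) :
    ∀ m : ℕ, x + n ≠ -(m : ℂ) := fun m h =>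
  hx (m + n) (by push_cast; linear_combination h)

/-- The terms of the series `₂F₁(A, B; C; 1)`. -/
noncomputable def gaussTerm (A B C : ℂ) (k : ℕ) : ℂ :=
  poch A k * poch B k / (poch C k * (k.factorial : ℂ))

/-- Euler's limit for `1 / Γ`, valid also at the poles of `Γ`. -/
lemma tendsto_poch_div (x : ℂ) :
    Tendsto (fun n : ℕ => poch x (n + 1) / ((n : ℂ) ^ x * n.factorial)) atTop (𝓝 (Gamma x)⁻¹) := by
  by_cases hx : ∃ m : ℕ, x = -(m : ℂ)
  · obtain ⟨m, rfl⟩ := hx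
    rw [Gamma_neg_nat_eq_zero, inv_zero]
    refine tendsto_const_nhds.congr' ?_
    filter_upwards [eventually_ge_atTop m] with n hn
    rw [poch, ascPochhammer_eval_neg_coe_nat_of_lt (by omega), zero_div]
  · push Not at hx
    refine ((GammaSeq_tendsto_Gamma x).inv₀ (Gamma_ne_zero hx)).congr fun n => ?_
    rw [GammaSeq, inv_div, poch_eq_prod]

lemma tendsto_poch_ratio (X Y : ℂ) {Z W : ℂ} (hZ : ∀ m : ℕ, Z ≠ -(m : ℂ))
    (hW : ∀ m : ℕ, W ≠ -(m : ℂ)) :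
    Tendsto (fun n : ℕ => poch X (n + 1) * poch Y (n + 1) / (poch Z (n + 1) * poch W (n + 1)) *
      (n : ℂ) ^ (Z + W - X - Y)) atTop (𝓝 (Gamma Z * Gamma W / (Gamma X * Gamma Y))) := by
  have h := ((tendsto_poch_div X).mul (tendsto_poch_div Y)).div
    ((tendsto_poch_div Z).mul (tendsto_poch_div W))
    (mul_ne_zero (inv_ne_zero (Gamma_ne_zero hZ)) (inv_ne_zero (Gamma_ne_zero hW)))
  rw [show Gamma Z * Gamma W / (Gamma X * Gamma Y) =
    (Gamma X)⁻¹ * (Gamma Y)⁻¹ / ((Gamma Z)⁻¹ * (Gamma W)⁻¹) by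
      simp only [div_eq_mul_inv, mul_inv, inv_inv]; ring]
  refine h.congr' ?_
  filter_upwards [eventually_ne_atTop 0] with n hn
  have hn' : (n : ℂ) ≠ 0 := Nat.cast_ne_zero.2 hn
  have h1 := poch_ne_zero hZ (n + 1)
  have h2 := poch_ne_zero hW (n + 1)
  have hf : (n.factorial : ℂ) ≠ 0 := Nat.cast_ne_zero.2 n.factorial_ne_zero
  have e (s : ℂ) : (n : ℂ) ^ s ≠ 0 := by simp [cpow_eq_zero_iff, hn']
  have eX := e X
  have eY := e Y
  rw [cpow_sub _ _ hn', cpow_sub _ _ hn', cpow_add _ _ hn']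
  simp only [Pi.div_apply]
  field_simp

lemma tendsto_gaussTerm_succ_mul_cpow (A B : ℂ) {C : ℂ} (hC : ∀ m : ℕ, C ≠ -(m : ℂ)) :
    Tendsto (fun n : ℕ => gaussTerm A B C (n + 1) * (n : ℂ) ^ (C + 1 - A - B)) atTop
      (𝓝 (Gamma C * Gamma 1 / (Gamma A * Gamma B))) := by
  simpa only [gaussTerm, poch_one] using tendsto_poch_ratio A B hC one_ne_neg_natCast

lemma gaussTerm_succ_isBigO (A B : ℂ) {C : ℂ} (hC : ∀ m : ℕ, C ≠ -(m : ℂ)) :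
    (fun n : ℕ => gaussTerm A B C (n + 1)) =O[atTop]
      fun n : ℕ => (n : ℝ) ^ (-(1 + (C - A - B).re)) := by
  have h := ((tendsto_gaussTerm_succ_mul_cpow A B hC).isBigO_one ℝ).mul
    (Asymptotics.isBigO_refl (fun n : ℕ => (n : ℂ) ^ (-(C + 1 - A - B))) atTop).norm_right
  refine (h.congr' ?_ .rfl).trans ?_
  · filter_upwards [eventually_ne_atTop 0] with n hn
    have hn' : (n : ℂ) ≠ 0 := Nat.cast_ne_zero.2 hn
    rw [mul_assoc, ← cpow_add _ _ hn', add_neg_cancel, cpow_zero, mul_one]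
  · refine Asymptotics.IsBigO.of_bound 1 ?_
    filter_upwards [eventually_gt_atTop 0] with n hn
    rw [one_mul, one_mul, norm_norm, norm_natCast_cpow_of_pos hn,
      Real.norm_of_nonneg (by positivity)]
    refine le_of_eq (congrArg _ ?_)
    simp
    ring

lemma summable_gaussTerm (A B : ℂ) {C : ℂ} (hC : ∀ m : ℕ, C ≠ -(m : ℂ))
    (h : 0 < (C - A - B).re) : Summable (gaussTerm A B C) := by
  rw [← summable_nat_add_iff 1]
  exact summable_of_isBigO_nat (Real.summable_nat_rpow.2 (by linarith))
    (gaussTerm_succ_isBigO A B hC)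

lemma tendsto_gaussTerm_zero (A B : ℂ) {C : ℂ} (hC : ∀ m : ℕ, C ≠ -(m : ℂ))
    (h : -1 < (C - A - B).re) : Tendsto (gaussTerm A B C) atTop (𝓝 0) := by
  rw [← tendsto_add_atTop_iff_nat 1]
  exact (gaussTerm_succ_isBigO A B hC).trans_tendsto
    ((tendsto_rpow_neg_atTop (by linarith)).comp tendsto_natCast_atTop_atTop)

lemma gaussTerm_zero (A B C : ℂ) : gaussTerm A B C 0 = 1 := by simp [gaussTerm, poch_zero]

lemma gaussTerm_succ (A B C : ℂ) (k : ℕ) :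
    gaussTerm A B C (k + 1) = gaussTerm A B C k * ((A + k) * (B + k) / ((C + k) * (k + 1))) := by
  rw [gaussTerm, gaussTerm, poch_succ, poch_succ, poch_succ, Nat.factorial_succ, div_mul_div_comm]
  push_cast
  congr 1 <;> ring

lemma gaussTerm_one_one (b : ℂ) (k : ℕ) : gaussTerm b 1 1 k = poch b k / k.factorial := by
  have hf : (k.factorial : ℂ) ≠ 0 := Nat.cast_ne_zero.2 k.factorial_ne_zero
  rw [gaussTerm, poch_one]
  field_simp

lemma tsum_gaussTerm_one_one_mul_neg_one_pow {b : ℂ} (hb : b.re < 0) :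
    ∑' k : ℕ, gaussTerm b 1 1 k * (-1) ^ k = (2 : ℂ) ^ (-b) := by
  have hs : Summable fun k : ℕ => gaussTerm b 1 1 k * (-1) ^ k :=
    .of_norm (by simpa using (summable_gaussTerm b 1 one_ne_neg_natCast (by simpa using hb)).norm)
  have h1 := tendsto_map'_iff.1 (tendsto_tsum_powerSeries_nhdsWithin_lt hs.hasSum.tendsto_sum_nat)
  have h2 : Tendsto (fun x : ℝ => (1 + (x : ℂ)) ^ (-b)) (𝓝[<] 1) (𝓝 ((2 : ℂ) ^ (-b))) := by
    have : ContinuousAt (fun x : ℝ => (1 + (x : ℂ)) ^ (-b)) 1 := by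
      refine ContinuousAt.cpow (by fun_prop) (by fun_prop) ?_
      simp [slitPlane]
    have := this.tendsto
    norm_num at this
    exact this.mono_left nhdsWithin_le_nhds
  refine tendsto_nhds_unique (h1.congr' ?_) h2
  filter_upwards [Ioo_mem_nhdsLT (zero_lt_one' ℝ)] with x hx
  have hx' : (x : ℂ) ∈ Metric.eball (0 : ℂ) 1 := by
    rw [← ENNReal.ofReal_one, Metric.eball_ofReal]
    simp [abs_of_pos hx.1, hx.2]
  have := (one_add_cpow_hasFPowerSeriesOnBall_zero (a := -b)).hasSum hx'
  rw [zero_add] at this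
  rw [← this.tsum_eq]
  refine tsum_congr fun k => ?_
  have hf : (k.factorial : ℂ) ≠ 0 := Nat.cast_ne_zero.2 k.factorial_ne_zero
  have e : (k.factorial : ℂ) * Ring.multichoose b k = poch b k := by
    rw [poch, ← Polynomial.ascPochhammer_smeval_eq_eval,
      ← Ring.factorial_nsmul_multichoose_eq_ascPochhammer, nsmul_eq_mul]
  rw [gaussTerm_one_one, ← e, binomialSeries_apply, Ring.choose_neg']
  simp [Units.smul_def, -FormalMultilinearSeries.apply_eq_prod_smul_coeff]
  field_simp
  simp

lemma mul_poch_add_one (x : ℂ) (k : ℕ) : x * poch (x + 1) k = poch x k * (x + k) := by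
  rw [← poch_succ_left, poch_succ]

lemma sum_gaussTerm_contiguous (A B : ℂ) {C : ℂ} (hC : ∀ m : ℕ, C ≠ -(m : ℂ)) (N : ℕ) :
    ∑ k ∈ range (N + 1), (C * (C - A - B) * gaussTerm A B C k
      - (C - A) * (C - B) * gaussTerm A B (C + 1) k) =
      -(A * B * gaussTerm (A + 1) (B + 1) (C + 1) N) := by
  induction N with
  | zero => simp [gaussTerm_zero]; ring
  | succ N ih =>
    rw [sum_range_succ, ih]
    have hC1 := ne_neg_natCast_add hC 1
    simp only [Nat.cast_one] at hC1
    have hR := poch_ne_zero hC1 N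
    have hf : (N.factorial : ℂ) ≠ 0 := Nat.cast_ne_zero.2 N.factorial_ne_zero
    have hC0 : C ≠ 0 := by simpa using hC 0
    have hN : (N : ℂ) + 1 ≠ 0 := Nat.cast_add_one_ne_zero N
    have hCN : C + 1 + N ≠ 0 := fun h => hC1 N (eq_neg_of_add_eq_zero_left h)
    simp only [gaussTerm, Nat.factorial_succ, poch_succ_left A, poch_succ_left B,
      poch_succ_left C, poch_succ (A + 1), poch_succ (B + 1), poch_succ (C + 1)]
    push_cast
    field_simp
    ring

lemma sum_kummer_shift_two (a b : ℂ) {c : ℂ} (hc : ∀ m : ℕ, c ≠ -(m : ℂ)) (h : c = 1 + a - b)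
    (N : ℕ) :
    ∑ k ∈ range (N + 1), (c * (c + 1) * (gaussTerm a b c k * (-1) ^ k)
      - (1 + a) * (2 + a - 2 * b) * (gaussTerm (a + 2) b (c + 2) k * (-1) ^ k)) =
      b * (1 - b) * (-1) ^ (N + 1) * gaussTerm (a + 1) (b + 1) (c + 2) N := by
  induction N with
  | zero => simp [gaussTerm_zero, h]; ring
  | succ N ih =>
    rw [sum_range_succ, ih]
    have hc2 := ne_neg_natCast_add hc 2
    simp only [Nat.cast_ofNat] at hc2
    have hR := poch_ne_zero hc2 N
    have hf : (N.factorial : ℂ) ≠ 0 := Nat.cast_ne_zero.2 N.factorial_ne_zero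
    have hc0 : c ≠ 0 := by simpa using hc 0
    have hc1 : c + 1 ≠ 0 := fun h => hc 1 (by push_cast; exact eq_neg_of_add_eq_zero_left h)
    have hN : (N : ℂ) + 1 ≠ 0 := Nat.cast_add_one_ne_zero N
    have hcN : c + 1 + N ≠ 0 := fun h => hc (N + 1) (by push_cast; linear_combination h)
    have hcN2 : c + 2 + N ≠ 0 := fun h => hc2 N (eq_neg_of_add_eq_zero_left h)
    have e1 : poch (c + 1) N = (c + 1) * poch (c + 2) N / (c + 1 + N) := by
      rw [eq_div_iff hcN, ← mul_poch_add_one, add_assoc c 1 1, one_add_one_eq_two]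
    have e2 : (1 + a) * poch (a + 2) N = poch (a + 1) N * (a + 1 + N) := by
      rw [← mul_poch_add_one, add_assoc a 1 1, one_add_one_eq_two, add_comm a 1]
    have e3 : (1 + a) * gaussTerm (a + 2) b (c + 2) (N + 1) =
        gaussTerm (a + 1) (b + 1) (c + 2) N *
          (b * (a + 2 + N) * (a + 1 + N) / ((N + 1) * (c + 2 + N))) := by
      simp only [gaussTerm, Nat.factorial_succ, poch_succ_left b, poch_succ (a + 2),
        poch_succ (c + 2)]
      push_cast
      field_simp
      linear_combination b * poch (b + 1) N * (a + 2 + N) * e2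
    have e4 : gaussTerm a b c (N + 1) = gaussTerm (a + 1) (b + 1) (c + 2) N *
          (a * b * (c + 1 + N) / (c * (c + 1) * (N + 1))) := by
      simp only [gaussTerm, Nat.factorial_succ, poch_succ_left a, poch_succ_left b,
        poch_succ_left c, e1]
      push_cast
      field_simp
    rw [mul_right_comm (1 + a), ← mul_assoc (1 + a), e3, e4, gaussTerm_succ]
    generalize gaussTerm (a + 1) (b + 1) (c + 2) N = u
    field_simp
    subst h
    ring

lemma sum_kummer_shift_neg_one (a b : ℂ) {c : ℂ} (hc : ∀ m : ℕ, c ≠ -(m : ℂ))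
    (h : c = 1 + a - b) (N : ℕ) :
    ∑ k ∈ range (N + 1), (c * (gaussTerm a b c k * (-1) ^ k)
      - (1 + a / 2 - b) * (gaussTerm a (b - 1) (c + 1) k * (-1) ^ k)) =
      a / 2 * (-1) ^ N * gaussTerm (a + 1) b (c + 1) N := by
  induction N with
  | zero => simp [gaussTerm_zero, h]; ring
  | succ N ih =>
    rw [sum_range_succ, ih]
    have hc1 := ne_neg_natCast_add hc 1
    simp only [Nat.cast_one] at hc1
    have hR := poch_ne_zero hc1 N
    have hf : (N.factorial : ℂ) ≠ 0 := Nat.cast_ne_zero.2 N.factorial_ne_zero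
    have hc0 : c ≠ 0 := by simpa using hc 0
    have hN : (N : ℂ) + 1 ≠ 0 := Nat.cast_add_one_ne_zero N
    have hcN : c + 1 + N ≠ 0 := fun h => hc1 N (eq_neg_of_add_eq_zero_left h)
    simp only [gaussTerm, Nat.factorial_succ, poch_succ_left a, poch_succ b, poch_succ_left (b - 1),
      sub_add_cancel, poch_succ_left c, poch_succ (a + 1), poch_succ (c + 1)]
    push_cast
    field_simp
    subst h
    ring

lemma tendsto_add_natCast_div_add_natCast (x y : ℂ) :
    Tendsto (fun n : ℕ => (x + n) / (y + n)) atTop (𝓝 1) := by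
  have := (tendsto_natCast_div_add_atTop y).div (tendsto_natCast_div_add_atTop x) one_ne_zero
  rw [div_one] at this
  refine this.congr' ?_
  filter_upwards [eventually_ne_atTop 0] with n hn
  rw [Pi.div_apply, div_div_div_cancel_left' _ _ (Nat.cast_ne_zero.2 hn), add_comm x, add_comm y]

lemma tendsto_inv_add_natCast (x : ℂ) :
    Tendsto (fun n : ℕ => (x + n)⁻¹) atTop (𝓝 0) := by
  have := (tendsto_inv_atTop_nhds_zero_nat (𝕜 := ℂ)).mul (tendsto_natCast_div_add_atTop x)
  rw [zero_mul] at this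
  refine this.congr' ?_
  filter_upwards [eventually_ne_atTop 0] with n hn
  have : (n : ℂ) ≠ 0 := Nat.cast_ne_zero.2 hn
  rw [div_eq_mul_inv, inv_mul_cancel_left₀ this, add_comm]

lemma tendsto_poch_add_div_poch_add (x y : ℂ) (k : ℕ) :
    Tendsto (fun n : ℕ => poch (x + n) k / poch (y + n) k) atTop (𝓝 1) := by
  have := tendsto_finsetProd (range k) fun j _ =>
    tendsto_add_natCast_div_add_natCast (x + j) (y + j)
  rw [prod_const_one] at this
  refine this.congr fun n => ?_
  rw [poch_eq_prod, poch_eq_prod, prod_div_distrib]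
  simp only [add_right_comm]

lemma tendsto_inv_poch_add (x : ℂ) (k : ℕ) :
    Tendsto (fun n : ℕ => (poch (x + n) k)⁻¹) atTop (𝓝 (0 ^ k)) := by
  have := tendsto_finsetProd (range k) fun j _ => tendsto_inv_add_natCast (x + j)
  rw [prod_const, card_range] at this
  refine this.congr fun n => ?_
  rw [poch_eq_prod, prod_inv_distrib]
  simp only [add_right_comm]

lemma norm_poch_le_norm_poch {x y : ℂ} (h : ∀ j : ℕ, ‖x + j‖ ≤ ‖y + j‖) (k : ℕ) :
    ‖poch x k‖ ≤ ‖poch y k‖ := by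
  rw [poch_eq_prod, poch_eq_prod, norm_prod, norm_prod]
  exact prod_le_prod (fun _ _ => norm_nonneg _) fun j _ => h j

lemma norm_add_natCast_le {x : ℂ} {m n : ℕ} (h : 0 ≤ x.re + m) (hmn : m ≤ n) (j : ℕ) :
    ‖x + m + j‖ ≤ ‖x + n + j‖ := by
  have hmn' : (m : ℝ) ≤ n := Nat.cast_le.2 hmn
  have hj : (0 : ℝ) ≤ j := j.cast_nonneg
  rw [← sq_le_sq₀ (norm_nonneg _) (norm_nonneg _), Complex.sq_norm, Complex.sq_norm, normSq_apply,
    normSq_apply]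
  simp
  nlinarith

lemma tsum_gaussTerm_contiguous (A B : ℂ) {C : ℂ} (hC : ∀ m : ℕ, C ≠ -(m : ℂ))
    (h : 0 < (C - A - B).re) :
    C * (C - A - B) * ∑' k, gaussTerm A B C k =
      (C - A) * (C - B) * ∑' k, gaussTerm A B (C + 1) k := by
  have hC1 := ne_neg_natCast_add hC 1
  simp only [Nat.cast_one] at hC1
  have s1 := (summable_gaussTerm A B hC h).hasSum.mul_left (C * (C - A - B))
  have s2 := (summable_gaussTerm A B hC1 (by simp at h ⊢; linarith)).hasSum.mul_left
    ((C - A) * (C - B))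
  have h1 := (tendsto_add_atTop_iff_nat 1).2 (s1.sub s2).tendsto_sum_nat
  simp only [sum_gaussTerm_contiguous A B hC] at h1
  have h2 := ((tendsto_gaussTerm_zero (A + 1) (B + 1) hC1
    (by simp at h ⊢; linarith)).const_mul (A * B)).neg
  rw [mul_zero, neg_zero] at h2
  exact sub_eq_zero.1 (tendsto_nhds_unique h1 h2)

lemma tsum_gaussTerm_eq_poch_ratio (A B : ℂ) {C : ℂ} (hC : ∀ m : ℕ, C ≠ -(m : ℂ))
    (h : 0 < (C - A - B).re) (n : ℕ) :
    ∑' k, gaussTerm A B C k = poch (C - A) n * poch (C - B) n / (poch C n * poch (C - A - B) n) *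
      ∑' k, gaussTerm A B (C + n) k := by
  induction n with
  | zero => simp [poch_zero]
  | succ n ih =>
    have hCn := ne_neg_natCast_add hC n
    have hre : 0 < (C + n - A - B).re := by
      have : (0 : ℝ) ≤ n := n.cast_nonneg
      simp at h ⊢
      linarith
    have key := tsum_gaussTerm_contiguous A B hCn hre
    have h0 : C + n ≠ 0 := by simpa using hCn 0
    have h1 : C - A - B + n ≠ 0 := fun h' => hre.ne' (by
      rw [show C + n - A - B = C - A - B + n by ring, h', zero_re])
    rw [ih, poch_succ, poch_succ, poch_succ, poch_succ, Nat.cast_succ, ← add_assoc,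
      show poch (C - A) n * (C - A + n) * (poch (C - B) n * (C - B + n)) /
        (poch C n * (C + n) * (poch (C - A - B) n * (C - A - B + n))) =
        poch (C - A) n * poch (C - B) n / (poch C n * poch (C - A - B) n) *
          ((C - A + n) * (C - B + n) / ((C + n) * (C - A - B + n))) by
        rw [div_mul_div_comm]; congr 1 <;> ring, mul_assoc]
    congr 1
    field_simp
    linear_combination key

lemma tendsto_tsum_gaussTerm_add_natCast (A B : ℂ) {C : ℂ} (hC : ∀ m : ℕ, C ≠ -(m : ℂ)) :
    Tendsto (fun n : ℕ => ∑' k, gaussTerm A B (C + n) k) atTop (𝓝 1) := by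
  obtain ⟨m, hm⟩ := exists_nat_gt (max (-C.re) (-(C - A - B).re))
  obtain ⟨hm1, hm2⟩ := max_lt_iff.1 hm
  have hCm := ne_neg_natCast_add hC m
  have hs := summable_gaussTerm A B hCm (by simp at hm2 ⊢; linarith)
  have e : ∑' k : ℕ, poch A k * poch B k / (k.factorial : ℂ) * 0 ^ k = 1 := by
    rw [tsum_eq_single 0 fun k hk => by simp [hk]]
    simp [poch_zero]
  rw [← e]
  refine tendsto_tsum_of_dominated_convergence hs.norm (fun k => ?_) ?_
  · refine ((tendsto_inv_poch_add C k).const_mul _).congr fun n => ?_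
    rw [gaussTerm]
    field_simp
  · filter_upwards [eventually_ge_atTop m] with n hn k
    have := norm_poch_le_norm_poch (fun j => norm_add_natCast_le (x := C) (by linarith) hn j) k
    have h0 := norm_pos_iff.2 (poch_ne_zero hCm k)
    have hf := norm_pos_iff.2 (Nat.cast_ne_zero (R := ℂ).2 k.factorial_ne_zero)
    simp only [gaussTerm, norm_div, norm_mul]
    gcongr

/-- Gauss's summation theorem. -/
lemma tsum_gaussTerm (A B : ℂ) {C : ℂ} (hC : ∀ m : ℕ, C ≠ -(m : ℂ))
    (h : 0 < (C - A - B).re) :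
    ∑' k, gaussTerm A B C k =
      Gamma C * Gamma (C - A - B) / (Gamma (C - A) * Gamma (C - B)) := by
  have hD (m : ℕ) : C - A - B ≠ -(m : ℂ) := fun h' => by
    rw [h'] at h
    have : (0 : ℝ) ≤ m := m.cast_nonneg
    simp at h
    linarith
  have h1 := (tendsto_poch_ratio (C - A) (C - B) hC hD).mul
    ((tendsto_add_atTop_iff_nat 1).2 (tendsto_tsum_gaussTerm_add_natCast A B hC))
  rw [mul_one] at h1
  refine tendsto_nhds_unique (tendsto_const_nhds.congr fun n => ?_) h1
  rw [show C + (C - A - B) - (C - A) - (C - B) = 0 by ring, cpow_zero, mul_one]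
  exact tsum_gaussTerm_eq_poch_ratio A B hC h (n + 1)

lemma summable_gaussTerm_mul_neg_one_pow (A B : ℂ) {C : ℂ} (hC : ∀ m : ℕ, C ≠ -(m : ℂ))
    (h : 0 < (C - A - B).re) : Summable fun k : ℕ => gaussTerm A B C k * (-1) ^ k :=
  .of_norm (by simpa using (summable_gaussTerm A B hC h).norm)

lemma tendsto_neg_one_pow_mul {f : ℕ → ℂ} (hf : Tendsto f atTop (𝓝 0)) :
    Tendsto (fun n => (-1) ^ n * f n) atTop (𝓝 0) := by
  rw [tendsto_zero_iff_norm_tendsto_zero] at hf ⊢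
  simpa using hf

lemma tsum_kummer_shift_two {a b c : ℂ} (hc : ∀ m : ℕ, c ≠ -(m : ℂ)) (h : c = 1 + a - b)
    (hb : b.re < 0) :
    c * (c + 1) * ∑' k : ℕ, gaussTerm a b c k * (-1) ^ k =
      (1 + a) * (2 + a - 2 * b) * ∑' k : ℕ, gaussTerm (a + 2) b (c + 2) k * (-1) ^ k := by
  have hc2 := ne_neg_natCast_add hc 2
  simp only [Nat.cast_ofNat] at hc2
  have s1 := (summable_gaussTerm_mul_neg_one_pow a b hc
    (by simp [h]; linarith)).hasSum.mul_left (c * (c + 1))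
  have s2 := (summable_gaussTerm_mul_neg_one_pow (a + 2) b hc2
    (by simp [h]; linarith)).hasSum.mul_left ((1 + a) * (2 + a - 2 * b))
  have h1 := (tendsto_add_atTop_iff_nat 1).2 (s1.sub s2).tendsto_sum_nat
  simp only [sum_kummer_shift_two a b hc h] at h1
  have h2 := (tendsto_neg_one_pow_mul (tendsto_gaussTerm_zero (a + 1) (b + 1) hc2
    (by simp [h]; linarith))).const_mul (-(b * (1 - b)))
  rw [mul_zero] at h2
  refine sub_eq_zero.1 (tendsto_nhds_unique (h1.congr fun n => ?_) h2)
  ring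

lemma tsum_kummer_eq_poch_ratio {a b c : ℂ} (hc : ∀ m : ℕ, c ≠ -(m : ℂ)) (h : c = 1 + a - b)
    (hb : b.re < 0) (n : ℕ) :
    ∑' k : ℕ, gaussTerm a b c k * (-1) ^ k =
      poch ((1 + a) / 2) n * poch (1 + a / 2 - b) n / (poch (c / 2) n * poch ((c + 1) / 2) n) *
        ∑' k : ℕ, gaussTerm (a + (2 * n : ℕ)) b (c + (2 * n : ℕ)) k * (-1) ^ k := by
  induction n with
  | zero => simp [poch_zero]
  | succ n ih =>
    have hcn := ne_neg_natCast_add hc (2 * n)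
    have key := tsum_kummer_shift_two (a := a + (2 * n : ℕ)) hcn (by rw [h]; ring) hb
    have h0 : c + 2 * n ≠ 0 := by simpa using hcn 0
    have h1 : c + 1 + 2 * n ≠ 0 := fun h' =>
      hcn 1 (by push_cast; linear_combination h')
    have e (x : ℂ) : x + (2 * (n + 1) : ℕ) = x + (2 * n : ℕ) + 2 := by push_cast; ring
    rw [ih, e, e, poch_succ, poch_succ, poch_succ, poch_succ,
      show poch ((1 + a) / 2) n * ((1 + a) / 2 + n) *
          (poch (1 + a / 2 - b) n * (1 + a / 2 - b + n)) /
        (poch (c / 2) n * (c / 2 + n) * (poch ((c + 1) / 2) n * ((c + 1) / 2 + n))) =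
        poch ((1 + a) / 2) n * poch (1 + a / 2 - b) n / (poch (c / 2) n * poch ((c + 1) / 2) n) *
          ((1 + a + 2 * n) * (2 + a + 2 * n - 2 * b) / ((c + 2 * n) * (c + 1 + 2 * n))) by
        rw [show c / 2 + n = (c + 2 * n) / 2 by ring,
          show (c + 1) / 2 + n = (c + 1 + 2 * n) / 2 by ring, div_mul_div_comm,
          ← mul_div_mul_left _ (poch (c / 2) n * ((c + 2 * n) / 2) *
            (poch ((c + 1) / 2) n * ((c + 1 + 2 * n) / 2))) (show (4 : ℂ) ≠ 0 by norm_num)]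
        congr 1 <;> ring, mul_assoc]
    congr 1
    push_cast at key ⊢
    field_simp
    linear_combination key

lemma tendsto_tsum_kummer_add_natCast {a b c : ℂ} (hc : ∀ m : ℕ, c ≠ -(m : ℂ))
    (h : c = 1 + a - b) (hb : b.re < 0) :
    Tendsto (fun n : ℕ => ∑' k : ℕ, gaussTerm (a + n) b (c + n) k * (-1) ^ k) atTop
      (𝓝 ((2 : ℂ) ^ (-b))) := by
  rw [← tsum_gaussTerm_one_one_mul_neg_one_pow hb]
  refine tendsto_tsum_of_dominated_convergence
    (summable_gaussTerm b 1 one_ne_neg_natCast (by simpa using hb)).norm (fun k => ?_) ?_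
  · have := ((tendsto_poch_add_div_poch_add a c k).const_mul (gaussTerm b 1 1 k)).mul_const
      ((-1 : ℂ) ^ k)
    rw [mul_one] at this
    refine this.congr fun n => ?_
    rw [gaussTerm_one_one, gaussTerm, div_mul_div_comm, mul_comm (poch b k),
      mul_comm (k.factorial : ℂ)]
  · obtain ⟨m, hm⟩ := exists_nat_gt (|a.im * b.im| - a.re)
    filter_upwards [eventually_ge_atTop m] with n hn k
    have hle : ‖poch (a + n) k‖ ≤ ‖poch (c + n) k‖ := by
      refine norm_poch_le_norm_poch (fun j => ?_) k
      have hmn : (m : ℝ) ≤ n := Nat.cast_le.2 hn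
      have hj : (0 : ℝ) ≤ j := j.cast_nonneg
      have hab := le_abs_self (a.im * b.im)
      have hab0 := abs_nonneg (a.im * b.im)
      rw [← sq_le_sq₀ (norm_nonneg _) (norm_nonneg _), Complex.sq_norm, Complex.sq_norm,
        normSq_apply, normSq_apply, h]
      simp
      have hx : |a.im * b.im| ≤ a.re + n + j := by linarith
      nlinarith [mul_nonneg (hab0.trans hx) (neg_nonneg.2 hb.le), sq_nonneg (1 - b.re),
        sq_nonneg b.im]
    have h0 := norm_pos_iff.2 (poch_ne_zero (ne_neg_natCast_add hc n) k)
    rw [norm_mul, norm_pow, norm_neg, norm_one, one_pow, mul_one, gaussTerm_one_one, gaussTerm,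
      mul_div_mul_comm, norm_mul, norm_div]
    exact mul_le_of_le_one_left (norm_nonneg _) ((div_le_one h0).2 hle)

/-- Kummer's summation theorem in the absolutely convergent range. -/
lemma tsum_kummer {a b c : ℂ} (hc : ∀ m : ℕ, c ≠ -(m : ℂ)) (h : c = 1 + a - b) (hb : b.re < 0) :
    ∑' k : ℕ, gaussTerm a b c k * (-1) ^ k =
      2 ^ (-a) * (Gamma c * Gamma (1 / 2) / (Gamma ((1 + a) / 2) * Gamma (1 + a / 2 - b))) := by
  have hc1 (m : ℕ) : c / 2 ≠ -(m : ℂ) := fun h' =>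
    hc (2 * m) (by push_cast; linear_combination 2 * h')
  have hc2 (m : ℕ) : (c + 1) / 2 ≠ -(m : ℂ) := fun h' =>
    hc (2 * m + 1) (by push_cast; linear_combination 2 * h')
  have h1 := (tendsto_poch_ratio ((1 + a) / 2) (1 + a / 2 - b) hc1 hc2).mul
    ((tendsto_tsum_kummer_add_natCast hc h hb).comp (g := fun n : ℕ => _)
      (f := fun n : ℕ => 2 * (n + 1))
      (tendsto_atTop_mono (fun n => show n ≤ 2 * (n + 1) by omega) tendsto_id))
  have hpi : ((√Real.pi : ℝ) : ℂ) = Gamma (1 / 2) := by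
    rw [← Real.Gamma_one_half_eq, ← Gamma_ofReal]
    norm_num
  have hpow : (2 : ℂ) ^ (1 - c) * 2 ^ (-b) = 2 ^ (-a) := by
    rw [← cpow_add _ _ two_ne_zero, h]
    congr 1
    ring
  refine (tendsto_nhds_unique (tendsto_const_nhds.congr fun n => ?_) h1).trans ?_
  · rw [show c / 2 + (c + 1) / 2 - (1 + a) / 2 - (1 + a / 2 - b) = 0 by rw [h]; ring, cpow_zero,
      mul_one]
    exact tsum_kummer_eq_poch_ratio hc h hb (n + 1)
  · rw [add_div c, Gamma_mul_Gamma_add_half, mul_div_cancel₀ c two_ne_zero, hpi, ← hpow]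
    ring

/-- Specialization of Kummer's quadratic transformation at `z = -1`:
`₂F₁(a, b; 1+a-b; -1) = 2^{-a} ₂F₁(a/2, 1/2+a/2-b; 1+a-b; 1)`,
both series converging (as limits of partial sums). -/
theorem kummer_quadratic_at_neg_one (a b : ℂ) (hb : b.re < 1)
    (h1 : ∀ m : ℕ, 1 + a - b ≠ -(m : ℂ)) :
    ∃ S : ℂ,
      Tendsto (fun N : ℕ => ∑ k ∈ range N,
          poch (a / 2) k * poch (1 / 2 + a / 2 - b) k /
            (poch (1 + a - b) k * (Nat.factorial k : ℂ)))
        atTop (𝓝 S) ∧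
      Tendsto (fun N : ℕ => ∑ k ∈ range N,
          poch a k * poch b k * (-1 : ℂ) ^ k /
            (poch (1 + a - b) k * (Nat.factorial k : ℂ)))
        atTop (𝓝 ((2 : ℂ) ^ (-a) * S)) := by
  obtain ⟨c, hc⟩ : ∃ c, c = 1 + a - b := ⟨_, rfl⟩
  rw [← hc] at h1 ⊢
  have hD : c - a / 2 - (1 / 2 + a / 2 - b) = 1 / 2 := by rw [hc]; ring
  have hre : 0 < (c - a / 2 - (1 / 2 + a / 2 - b)).re := by rw [hD]; norm_num
  refine ⟨∑' k, gaussTerm (a / 2) (1 / 2 + a / 2 - b) c k,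
    (summable_gaussTerm _ _ h1 hre).hasSum.tendsto_sum_nat, ?_⟩
  have hc1 := ne_neg_natCast_add h1 1
  simp only [Nat.cast_one] at hc1
  have hc0 : c ≠ 0 := by simpa using h1 0
  have s := (summable_gaussTerm_mul_neg_one_pow a (b - 1) hc1
    (by simp [hc]; linarith)).hasSum.mul_left (1 + a / 2 - b)
  have t1 := (tendsto_add_atTop_iff_nat 1).2 s.tendsto_sum_nat
  have t2 := (tendsto_neg_one_pow_mul (tendsto_gaussTerm_zero (a + 1) b hc1
    (by simp [hc]; linarith))).const_mul (a / 2)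
  have t := (t2.add t1).const_mul c⁻¹
  rw [mul_zero, zero_add, tsum_kummer hc1 (by rw [hc]; ring) (by simp; linarith)] at t
  rw [← tendsto_add_atTop_iff_nat 1, tsum_gaussTerm _ _ h1 hre, hD]
  have hval : (2 : ℂ) ^ (-a) * (Gamma c * Gamma (1 / 2) /
      (Gamma (c - a / 2) * Gamma (c - (1 / 2 + a / 2 - b)))) =
      c⁻¹ * ((1 + a / 2 - b) * (2 ^ (-a) * (Gamma (c + 1) * Gamma (1 / 2) /
        (Gamma ((1 + a) / 2) * Gamma (1 + a / 2 - (b - 1)))))) := by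
    rw [show c - a / 2 = 1 + a / 2 - b by rw [hc]; ring,
      show c - (1 / 2 + a / 2 - b) = (1 + a) / 2 by rw [hc]; ring,
      show 1 + a / 2 - (b - 1) = 1 + a / 2 - b + 1 by ring, Gamma_add_one c hc0,
      div_eq_mul_inv, mul_inv, one_div_Gamma_eq_self_mul_one_div_Gamma_add_one (1 + a / 2 - b),
      div_eq_mul_inv _ (Gamma ((1 + a) / 2) * _), mul_inv]
    field_simp
  rw [hval]
  refine t.congr fun N => ?_
  rw [← mul_assoc, ← sum_kummer_shift_neg_one a b h1 hc, sum_sub_distrib, ← mul_sum, ← mul_sum,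
    sub_add_cancel, inv_mul_cancel_left₀ hc0]
  refine sum_congr rfl fun k _ => ?_
  rw [gaussTerm, div_mul_eq_mul_div]
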